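/- arXiv:1509.03204 — 2 statements merged into one kernel-verified Lean document; each statement's English description precedes it below -/
import Mathlib

section
/- There is an absolute constant C such that the following holds. Let ℰ : [0,∞) → ℂ be continuous at 0 with ℰ(0) = 0, continuously differentiable on (0,∞), and compactly supported. Then for every t > 2, | ∫₀^∞ e^{itλ²} λ ℰ(λ) dλ | ≤ C [ (1/t) ∫₀^∞ |ℰ′(λ)| / (1 + λ² t) dλ + (1/t) ∫_{t^{−1/2}}^∞ | ℰ′( λ √(1 + π t^{−1} λ^{−2}) ) − ℰ′(λ) | dλ ], provided the right-hand side is finite. -/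
open MeasureTheory Real Complex Set

noncomputable section

theorem hasDerivAt_sqrt_sq_add {c : ℝ} (hc : 0 < c) (x : ℝ) :
    HasDerivAt (fun y : ℝ => √(y ^ 2 + c)) (x / √(x ^ 2 + c)) x := by
  have hx : x ^ 2 + c ≠ 0 := by positivity
  refine (((hasDerivAt_pow 2 x).add_const c).sqrt hx).congr_deriv ?_
  rw [Nat.cast_ofNat, show 2 - 1 = 1 from rfl, pow_one, mul_div_mul_left _ _ two_ne_zero]

theorem injOn_sqrt_sq_add {c a : ℝ} (hc : 0 < c) (ha : 0 < a) :
    InjOn (fun y : ℝ => √(y ^ 2 + c)) (Ioi a) := by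
  intro x hx y hy hxy
  have hx0 : 0 < x := ha.trans hx
  have hy0 : 0 < y := ha.trans hy
  have h := (Real.sqrt_inj (by positivity) (by positivity)).1 hxy
  exact (pow_left_inj₀ hx0.le hy0.le two_ne_zero).1 (by linarith)

theorem image_sqrt_sq_add_Ioi {c a : ℝ} (hc : 0 < c) (ha : 0 < a) :
    (fun y : ℝ => √(y ^ 2 + c)) '' Ioi a = Ioi √(a ^ 2 + c) := by
  ext y
  constructor
  · rintro ⟨x, hx, rfl⟩
    have hx' : a < x := hx
    exact Real.sqrt_lt_sqrt (by positivity) (by gcongr)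
  · intro hy
    have hy0 : 0 < y := (Real.sqrt_nonneg _).trans_lt hy
    have h : a ^ 2 + c < y ^ 2 := (Real.sqrt_lt' hy0).1 hy
    refine ⟨√(y ^ 2 - c), (Real.lt_sqrt ha.le).2 (by linarith), ?_⟩
    have h0 : 0 ≤ y ^ 2 - c := by nlinarith [sq_nonneg a]
    simp only
    rw [Real.sq_sqrt h0, sub_add_cancel, Real.sqrt_sq hy0.le]

section ChangeOfVariables

variable {F : Type*} [NormedAddCommGroup F] [NormedSpace ℝ F]

theorem integral_Ioi_comp_sqrt_sq_add {c a : ℝ} (hc : 0 < c) (ha : 0 < a) (g : ℝ → F) :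
    ∫ x in Ioi √(a ^ 2 + c), g x =
      ∫ x in Ioi a, (x / √(x ^ 2 + c)) • g √(x ^ 2 + c) := by
  rw [← image_sqrt_sq_add_Ioi hc ha, integral_image_eq_integral_abs_deriv_smul measurableSet_Ioi
    (fun x _ => (hasDerivAt_sqrt_sq_add hc x).hasDerivWithinAt) (injOn_sqrt_sq_add hc ha)]
  refine setIntegral_congr_fun measurableSet_Ioi fun x hx => ?_
  have hx0 : 0 < x := ha.trans hx
  rw [abs_of_nonneg (by positivity)]

theorem integrableOn_Ioi_comp_sqrt_sq_add {c a : ℝ} (hc : 0 < c) (ha : 0 < a) {g : ℝ → F}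
    (hg : IntegrableOn g (Ioi √(a ^ 2 + c))) :
    IntegrableOn (fun x => (x / √(x ^ 2 + c)) • g √(x ^ 2 + c)) (Ioi a) := by
  rw [← image_sqrt_sq_add_Ioi hc ha, integrableOn_image_iff_integrableOn_abs_deriv_smul
    measurableSet_Ioi (fun x _ => (hasDerivAt_sqrt_sq_add hc x).hasDerivWithinAt)
    (injOn_sqrt_sq_add hc ha)] at hg
  refine hg.congr_fun (fun x hx => ?_) measurableSet_Ioi
  have hx0 : 0 < x := ha.trans hx
  simp only
  rw [abs_of_nonneg (by positivity)]

end ChangeOfVariables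

theorem norm_exp_I_mul_mul_sq (t l : ℝ) : ‖Complex.exp (Complex.I * t * l ^ 2)‖ = 1 := by
  have : Complex.I * t * l ^ 2 = ((t * l ^ 2 : ℝ) : ℂ) * Complex.I := by push_cast; ring
  rw [this, Complex.norm_exp_ofReal_mul_I]

theorem exp_I_mul_mul_sqrt_sq {t : ℝ} (ht : 0 < t) (l : ℝ) :
    Complex.exp (Complex.I * t * (√(l ^ 2 + π / t) : ℝ) ^ 2) =
      -Complex.exp (Complex.I * t * l ^ 2) := by
  have h0 : 0 ≤ l ^ 2 + π / t := by positivity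
  have ht' : (t : ℂ) ≠ 0 := by exact_mod_cast ht.ne'
  rw [← Complex.ofReal_pow, Real.sq_sqrt h0]
  have : Complex.I * t * ((l ^ 2 + π / t : ℝ) : ℂ) = Complex.I * t * l ^ 2 + π * Complex.I := by
    push_cast
    field_simp
  rw [this, Complex.exp_add, Complex.exp_pi_mul_I]
  ring

theorem integrableOn_exp_I_mul_mul_sq_mul {t : ℝ} {h : ℝ → ℂ} {s : Set ℝ}
    (hh : IntegrableOn h s) :
    IntegrableOn (fun l : ℝ => Complex.exp (Complex.I * t * l ^ 2) * h l) s := by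
  refine hh.bdd_mul (c := 1) (Continuous.aestronglyMeasurable (by fun_prop)) ?_
  exact Filter.Eventually.of_forall fun l => (norm_exp_I_mul_mul_sq t l).le

/-- On a window where `λ² t` is bounded, the oscillatory integral is controlled by the weighted
`L¹` norm of the amplitude. -/
theorem norm_setIntegral_exp_mul_le_of_bounded {t K : ℝ} (ht : 0 < t) (hK : 0 ≤ K)
    {h : ℝ → ℂ} {s : Set ℝ} (hs : MeasurableSet s) (hs0 : s ⊆ Ioi 0)
    (hsK : ∀ l ∈ s, 1 + l ^ 2 * t ≤ K)
    (hw : IntegrableOn (fun l : ℝ => ‖h l‖ / (1 + l ^ 2 * t)) (Ioi 0)) :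
    ‖∫ l in s, Complex.exp (Complex.I * t * l ^ 2) * h l‖ ≤
      K * ∫ l in Ioi (0 : ℝ), ‖h l‖ / (1 + l ^ 2 * t) := by
  calc ‖∫ l in s, Complex.exp (Complex.I * t * l ^ 2) * h l‖
      ≤ ∫ l in s, K * (‖h l‖ / (1 + l ^ 2 * t)) := by
        refine norm_integral_le_of_norm_le ((hw.mono_set hs0).const_mul K) ?_
        filter_upwards [ae_restrict_mem hs] with l hl
        rw [norm_mul, norm_exp_I_mul_mul_sq, one_mul, ← mul_div_assoc,
          le_div_iff₀ (by positivity), mul_comm]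
        exact mul_le_mul_of_nonneg_right (hsK l hl) (norm_nonneg _)
    _ = K * ∫ l in s, ‖h l‖ / (1 + l ^ 2 * t) := integral_const_mul _ _
    _ ≤ _ := by
        refine mul_le_mul_of_nonneg_left (setIntegral_mono_set hw ?_ hs0.eventuallyLE) hK
        exact Filter.Eventually.of_forall fun l => by positivity

theorem one_sub_div_sqrt_le {t l : ℝ} (ht : 0 < t) (hl : 0 < l) (htl : 1 ≤ l ^ 2 * t) :
    1 - l / √(l ^ 2 + π / t) ≤
      12 * (l / √(l ^ 2 + π / t) / (1 + √(l ^ 2 + π / t) ^ 2 * t)) := by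
  have hc : 0 < π / t := by positivity
  have hct : π / t * t = π := div_mul_cancel₀ _ ht.ne'
  set m := √(l ^ 2 + π / t)
  have hm2 : m ^ 2 = l ^ 2 + π / t := Real.sq_sqrt (by positivity)
  have hlm : l ≤ m := Real.le_sqrt_of_sq_le (by linarith)
  have hm0 : 0 < m := hl.trans_le hlm
  have hmt : m ^ 2 * t = l ^ 2 * t + π := by rw [hm2, add_mul, hct]
  have hdiff : (m - l) * (2 * l * t) ≤ π := by
    have : (m - l) * (m + l) * t = π := by linear_combination hmt
    nlinarith [mul_nonneg (mul_nonneg (sub_nonneg.2 hlm) (sub_nonneg.2 hlm)) ht.le]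
  have hpi := Real.pi_lt_four
  have key : (m - l) * (1 + m ^ 2 * t) ≤ 12 * l := by
    have h1 : 1 + m ^ 2 * t ≤ 6 * (l ^ 2 * t) := by rw [hmt]; linarith
    calc (m - l) * (1 + m ^ 2 * t) ≤ (m - l) * (6 * (l ^ 2 * t)) :=
          mul_le_mul_of_nonneg_left h1 (sub_nonneg.2 hlm)
      _ = (m - l) * (2 * l * t) * (3 * l) := by ring
      _ ≤ 4 * (3 * l) := by gcongr; linarith
      _ = 12 * l := by ring
  have : 0 < 1 + m ^ 2 * t := by positivity
  rw [one_sub_div hm0.ne', div_div, ← mul_div_assoc, div_le_div_iff₀ hm0 (by positivity)]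
  nlinarith [mul_le_mul_of_nonneg_left key hm0.le]

/-- Cancellation over half-periods: `λ ↦ √(λ² + π / t)` flips the sign of `e^{itλ²}`. -/
theorem norm_integral_Ioi_exp_mul_le {t : ℝ} (ht : 0 < t) {h : ℝ → ℂ}
    (hh : IntegrableOn h (Ioi 0))
    (hw : IntegrableOn (fun l : ℝ => ‖h l‖ / (1 + l ^ 2 * t)) (Ioi 0))
    {a : ℝ} (ha : 0 < a) (hat : a ^ 2 * t = 1)
    (hd : IntegrableOn (fun l : ℝ => ‖h √(l ^ 2 + π / t) - h l‖) (Ioi a)) :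
    ‖∫ l in Ioi (0 : ℝ), Complex.exp (Complex.I * t * l ^ 2) * h l‖ ≤
      11 * (∫ l in Ioi (0 : ℝ), ‖h l‖ / (1 + l ^ 2 * t)) +
        ∫ l in Ioi a, ‖h √(l ^ 2 + π / t) - h l‖ := by
  set A := ∫ l in Ioi (0 : ℝ), ‖h l‖ / (1 + l ^ 2 * t)
  set B := ∫ l in Ioi a, ‖h √(l ^ 2 + π / t) - h l‖
  set b := √(a ^ 2 + π / t) with hb
  let e : ℝ → ℂ := fun l => Complex.exp (Complex.I * t * l ^ 2)
  have hc : 0 < π / t := by positivity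
  have hct : π / t * t = π := div_mul_cancel₀ _ ht.ne'
  have hpi := Real.pi_lt_four
  have hb2 : b ^ 2 = a ^ 2 + π / t := Real.sq_sqrt (by positivity)
  have hab : a ≤ b := Real.le_sqrt_of_sq_le (by linarith)
  have hb0 : 0 < b := ha.trans_le hab
  have hbt : b ^ 2 * t = 1 + π := by rw [hb2, add_mul, hct, hat]
  have hint : IntegrableOn (fun l => e l * h l) (Ioi 0) := integrableOn_exp_I_mul_mul_sq_mul hh
  have hint_a : IntegrableOn (fun l => e l * h l) (Ioi a) :=
    hint.mono_set (Ioi_subset_Ioi ha.le)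
  have hint_b : IntegrableOn (fun l => e l * h l) (Ioi b) :=
    hint.mono_set (Ioi_subset_Ioi hb0.le)
  have split_a : ∫ l in Ioi (0 : ℝ), e l * h l =
      (∫ l in Ioc 0 a, e l * h l) + ∫ l in Ioi a, e l * h l := by
    rw [← Ioc_union_Ioi_eq_Ioi ha.le]
    exact setIntegral_union (Ioc_disjoint_Ioi le_rfl) measurableSet_Ioi
      (hint.mono_set Ioc_subset_Ioi_self) hint_a
  have split_b : ∫ l in Ioi a, e l * h l =
      (∫ l in Ioc a b, e l * h l) + ∫ l in Ioi b, e l * h l := by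
    rw [← Ioc_union_Ioi_eq_Ioi hab]
    exact setIntegral_union (Ioc_disjoint_Ioi le_rfl) measurableSet_Ioi
      (hint_a.mono_set Ioc_subset_Ioi_self) hint_b
  have bound_a : ‖∫ l in Ioc 0 a, e l * h l‖ ≤ 2 * A := by
    refine norm_setIntegral_exp_mul_le_of_bounded ht two_pos.le measurableSet_Ioc
      Ioc_subset_Ioi_self (fun l hl => ?_) hw
    have : l ^ 2 * t ≤ a ^ 2 * t := by
      have := hl.1.le
      have := hl.2
      gcongr
    linarith
  have bound_b : ‖∫ l in Ioc a b, e l * h l‖ ≤ 6 * A := by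
    refine norm_setIntegral_exp_mul_le_of_bounded ht (by norm_num) measurableSet_Ioc
      (Ioc_subset_Ioi_self.trans (Ioi_subset_Ioi ha.le)) (fun l hl => ?_) hw
    have : l ^ 2 * t ≤ b ^ 2 * t := by
      have := ha.le.trans hl.1.le
      have := hl.2
      gcongr
    linarith
  have shift : ∫ l in Ioi b, e l * h l =
      -∫ l in Ioi a, e l * ((l / √(l ^ 2 + π / t)) • h √(l ^ 2 + π / t)) := by
    rw [hb, integral_Ioi_comp_sqrt_sq_add hc ha, ← integral_neg]
    congr 1 with l
    simp only [e, exp_I_mul_mul_sqrt_sq ht, Complex.real_smul]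
    ring
  have hint_shift : IntegrableOn
      (fun l => e l * ((l / √(l ^ 2 + π / t)) • h √(l ^ 2 + π / t))) (Ioi a) :=
    integrableOn_exp_I_mul_mul_sq_mul
      (integrableOn_Ioi_comp_sqrt_sq_add hc ha (hh.mono_set (Ioi_subset_Ioi hb0.le)))
  have hw_b : IntegrableOn (fun l : ℝ => ‖h l‖ / (1 + l ^ 2 * t)) (Ioi b) :=
    hw.mono_set (Ioi_subset_Ioi hb0.le)
  have hw_shift := integrableOn_Ioi_comp_sqrt_sq_add hc ha hw_b
  have tail_le : ∫ l in Ioi b, ‖h l‖ / (1 + l ^ 2 * t) ≤ A :=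
    setIntegral_mono_set hw (Filter.Eventually.of_forall fun l => by positivity)
      (Ioi_subset_Ioi hb0.le).eventuallyLE
  have bound_diff : ‖(∫ l in Ioi a, e l * h l) -
      ∫ l in Ioi a, e l * ((l / √(l ^ 2 + π / t)) • h √(l ^ 2 + π / t))‖ ≤ B + 12 * A := by
    rw [← integral_sub hint_a hint_shift]
    refine (norm_integral_le_of_norm_le (hd.add (hw_shift.const_mul 12)) ?_).trans ?_
    · filter_upwards [ae_restrict_mem measurableSet_Ioi] with l hl
      have hal : a < l := hl
      have hl0 : 0 < l := ha.trans hal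
      have htl : 1 ≤ l ^ 2 * t := by rw [← hat]; gcongr
      have key := one_sub_div_sqrt_le ht hl0 htl
      have hlm : l ≤ √(l ^ 2 + π / t) := Real.le_sqrt_of_sq_le (by linarith)
      simp only [Pi.add_apply, smul_eq_mul]
      set m := √(l ^ 2 + π / t)
      have hm0 : 0 < m := hl0.trans_le hlm
      have hr : 0 ≤ 1 - l / m := sub_nonneg.2 ((div_le_one hm0).2 hlm)
      have hsplit : h l - (l / m) • h m = -(h m - h l) + (1 - l / m) • h m := by
        rw [sub_smul, one_smul]; ring
      rw [← mul_sub, norm_mul, norm_exp_I_mul_mul_sq, one_mul, hsplit]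
      refine (norm_add_le _ _).trans ?_
      rw [norm_neg, norm_smul, Real.norm_of_nonneg hr]
      refine add_le_add le_rfl ((mul_le_mul_of_nonneg_right key (norm_nonneg _)).trans_eq ?_)
      ring
    · rw [integral_add' hd (hw_shift.const_mul 12), integral_const_mul,
        ← integral_Ioi_comp_sqrt_sq_add hc ha (fun l : ℝ => ‖h l‖ / (1 + l ^ 2 * t))]
      exact add_le_add le_rfl (mul_le_mul_of_nonneg_left tail_le (by norm_num))
  have two_mul_eq : 2 * ∫ l in Ioi a, e l * h l = (∫ l in Ioc a b, e l * h l) +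
      ((∫ l in Ioi a, e l * h l) -
        ∫ l in Ioi a, e l * ((l / √(l ^ 2 + π / t)) • h √(l ^ 2 + π / t))) := by
    linear_combination split_b + shift
  have bound_tail : 2 * ‖∫ l in Ioi a, e l * h l‖ ≤ 6 * A + (B + 12 * A) := by
    have := congrArg norm two_mul_eq
    rw [norm_mul, Complex.norm_two] at this
    rw [this]
    exact (norm_add_le _ _).trans (add_le_add bound_b bound_diff)
  have hB0 : 0 ≤ B := integral_nonneg fun l => norm_nonneg _
  change ‖∫ l in Ioi (0 : ℝ), e l * h l‖ ≤ _
  rw [split_a]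
  refine (norm_add_le _ _).trans ?_
  linarith

theorem integrableOn_of_continuousOn_Ici_of_eq_zero {f : ℝ → ℂ} {R : ℝ}
    (hf : ContinuousOn f (Ici 0)) (hR : ∀ l, R < l → f l = 0) : IntegrableOn f (Ioi 0) := by
  have h : IntegrableOn f (Icc 0 R) :=
    (hf.mono Icc_subset_Ici_self).integrableOn_compact isCompact_Icc
  refine h.of_forall_sdiff_eq_zero measurableSet_Ioi fun l hl => hR l ?_
  by_contra! hlR
  exact hl.2 ⟨(mem_Ioi.1 hl.1).le, hlR⟩

/-- Integration by parts against `e^{itλ²}` for an amplitude vanishing at the origin. -/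
theorem integral_exp_mul_eq_of_zero {E : ℝ → ℂ} (hE : ContinuousOn E (Ici 0)) (hE0 : E 0 = 0)
    (hdiff : ∀ l ∈ Ioi (0 : ℝ), HasDerivAt E (deriv E l) l) {R : ℝ} (hR : ∀ l, R < l → E l = 0)
    (hint : IntegrableOn (deriv E) (Ioi 0)) (t : ℝ) :
    2 * Complex.I * t * ∫ l in Ioi (0 : ℝ), Complex.exp (Complex.I * t * l ^ 2) * l * E l =
      -∫ l in Ioi (0 : ℝ), Complex.exp (Complex.I * t * l ^ 2) * deriv E l := by
  let e : ℝ → ℂ := fun l => Complex.exp (Complex.I * t * l ^ 2)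
  have he : Continuous e := by fun_prop
  have hde : ∀ l : ℝ, HasDerivAt e (e l * (2 * Complex.I * t * l)) l := fun l => by
    have h1 : HasDerivAt (fun z : ℂ => Complex.exp (Complex.I * t * z ^ 2))
        (Complex.exp (Complex.I * t * (l : ℂ) ^ 2) * (Complex.I * t * (2 * (l : ℂ)))) (l : ℂ) := by
      simpa using (((hasDerivAt_id (l : ℂ)).pow 2).const_mul (Complex.I * t)).cexp
    refine h1.comp_ofReal.congr_deriv ?_
    simp only [e]
    ring
  have hint_left : IntegrableOn (fun l : ℝ => e l * l * E l) (Ioi 0) :=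
    integrableOn_of_continuousOn_Ici_of_eq_zero (R := R)
      ((he.mul Complex.continuous_ofReal).continuousOn.mul hE) fun l hl => by simp [hR l hl]
  have hint_right : IntegrableOn (fun l : ℝ => e l * deriv E l) (Ioi 0) :=
    integrableOn_exp_I_mul_mul_sq_mul hint
  have htend : Filter.Tendsto (fun l => e l * E l) Filter.atTop (nhds 0) := by
    refine tendsto_const_nhds.congr' ?_
    filter_upwards [Filter.eventually_gt_atTop R] with l hl
    simp [hR l hl]
  have hftc := integral_Ioi_of_hasDerivAt_of_tendsto (a := 0) (m := 0)
    (f := fun l => e l * E l)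
    (f' := fun l => 2 * Complex.I * t * (e l * l * E l) + e l * deriv E l)
    ((he.continuousOn.mul hE) 0 self_mem_Ici)
    (fun l hl => ((hde l).mul (hdiff l hl)).congr_deriv (by ring))
    ((hint_left.const_mul _).add hint_right) htend
  rw [integral_add (hint_left.const_mul _) hint_right, integral_const_mul, hE0, mul_zero,
    sub_zero] at hftc
  exact eq_neg_of_add_eq_zero_left hftc

/-- The weight `1 + λ² t` is bounded on the support of a compactly supported function. -/
theorem integrableOn_deriv_of_weighted {E : ℝ → ℂ} {R : ℝ} (hR : ∀ l, R < l → E l = 0) {t : ℝ}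
    (ht : 0 < t) (hw : IntegrableOn (fun l : ℝ => ‖deriv E l‖ / (1 + l ^ 2 * t)) (Ioi 0)) :
    IntegrableOn (deriv E) (Ioi 0) := by
  refine (hw.const_mul (1 + R ^ 2 * t)).mono' (aestronglyMeasurable_deriv E _) ?_
  filter_upwards [ae_restrict_mem measurableSet_Ioi] with l hl
  have hl0 : 0 < l := hl
  rcases le_or_gt l R with hlR | hlR
  · rw [← mul_div_assoc, le_div_iff₀ (by positivity), mul_comm]
    gcongr
  · have : E =ᶠ[nhds l] fun _ => 0 := by
      filter_upwards [lt_mem_nhds hlR] with x hx using hR x hx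
    rw [this.deriv_eq]
    simp

/-- Stationary phase estimate (Lemma `lem:ibp2`): if the compactly supported
amplitude `ℰ` vanishes at `0` and is `C¹` on `(0,∞)`, then for `t > 2`,
`|∫₀^∞ e^{itλ²} λ ℰ(λ) dλ| ≤ C[ t⁻¹∫₀^∞ |ℰ′(λ)|/(1+λ²t) dλ
  + t⁻¹∫_{t^{-1/2}}^∞ |ℰ′(λ√(1+πt⁻¹λ⁻²)) − ℰ′(λ)| dλ ]`,
provided the right-hand side is finite. -/
theorem stationary_phase_vanishing_amplitude :
    ∃ C : ℝ, 0 < C ∧ ∀ E : ℝ → ℂ,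
      ContinuousWithinAt E (Set.Ici 0) 0 →
      E 0 = 0 →
      ContDiffOn ℝ 1 E (Set.Ioi 0) →
      HasCompactSupport E →
      ∀ t : ℝ, 2 < t →
        IntegrableOn (fun l : ℝ => ‖deriv E l‖ / (1 + l ^ 2 * t)) (Set.Ioi 0) →
        IntegrableOn
          (fun l : ℝ => ‖deriv E (l * Real.sqrt (1 + Real.pi * t⁻¹ * l⁻¹ ^ 2)) - deriv E l‖)
          (Set.Ioi (t ^ (-(1:ℝ)/2))) →
        ‖∫ l in Set.Ioi (0:ℝ), Complex.exp (Complex.I * t * l ^ 2) * l * E l‖ ≤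
          C * ((1 / t) * (∫ l in Set.Ioi (0:ℝ), ‖deriv E l‖ / (1 + l ^ 2 * t)) +
            (1 / t) *
              ∫ l in Set.Ioi (t ^ (-(1:ℝ)/2)),
                ‖deriv E (l * Real.sqrt (1 + Real.pi * t⁻¹ * l⁻¹ ^ 2)) - deriv E l‖) := by
  refine ⟨6, by norm_num, fun E hE hE0 hC1 hcs t ht2 hw hd => ?_⟩
  have ht : 0 < t := by linarith
  have hdiff : ∀ l ∈ Ioi (0 : ℝ), HasDerivAt E (deriv E l) l := fun l hl =>
    ((hC1.differentiableOn one_ne_zero).differentiableAt (Ioi_mem_nhds hl)).hasDerivAt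
  have hcont : ContinuousOn E (Ici 0) := fun l hl => by
    rcases (mem_Ici.1 hl).eq_or_lt with rfl | hl0
    · exact hE
    · exact (hdiff l hl0).continuousAt.continuousWithinAt
  obtain ⟨R, hR⟩ : ∃ R, ∀ l, R < l → E l = 0 := by
    obtain ⟨R, hR⟩ := hcs.isCompact.bddAbove
    refine ⟨R, fun l hl => image_eq_zero_of_notMem_tsupport fun hmem => ?_⟩
    exact (hR hmem).not_gt hl
  have hint := integrableOn_deriv_of_weighted hR ht hw
  have ha : 0 < t ^ (-(1:ℝ)/2) := by positivity
  have hat : (t ^ (-(1:ℝ)/2)) ^ 2 * t = 1 := by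
    rw [← Real.rpow_natCast, ← Real.rpow_mul ht.le]
    norm_num [Real.rpow_neg_one, ht.ne']
  have hphase : ∀ l ∈ Ioi (t ^ (-(1:ℝ)/2)),
      l * √(1 + π * t⁻¹ * l⁻¹ ^ 2) = √(l ^ 2 + π / t) := fun l hl => by
    have hl0 : 0 < l := ha.trans hl
    rw [show l ^ 2 + π / t = l ^ 2 * (1 + π * t⁻¹ * l⁻¹ ^ 2) by field_simp,
      Real.sqrt_mul (by positivity), Real.sqrt_sq hl0.le]
  have hcongr : EqOn
      (fun l : ℝ => ‖deriv E (l * √(1 + π * t⁻¹ * l⁻¹ ^ 2)) - deriv E l‖)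
      (fun l : ℝ => ‖deriv E √(l ^ 2 + π / t) - deriv E l‖) (Ioi (t ^ (-(1:ℝ)/2))) :=
    fun l hl => by simp only [hphase l hl]
  rw [setIntegral_congr_fun measurableSet_Ioi hcongr]
  have hmain := norm_integral_Ioi_exp_mul_le ht hint hw ha hat
    (hd.congr_fun hcongr measurableSet_Ioi)
  have hparts := congrArg norm (integral_exp_mul_eq_of_zero hcont hE0 hdiff hR hint t)
  rw [norm_neg, norm_mul, norm_mul, norm_mul, Complex.norm_two, Complex.norm_I,
    Complex.norm_of_nonneg ht.le] at hparts
  rw [← hparts] at hmain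
  set A := ∫ l in Ioi (0 : ℝ), ‖deriv E l‖ / (1 + l ^ 2 * t)
  set B := ∫ l in Ioi (t ^ (-(1:ℝ)/2)), ‖deriv E √(l ^ 2 + π / t) - deriv E l‖
  have hA0 : 0 ≤ A := integral_nonneg fun l => by positivity
  have hB0 : 0 ≤ B := integral_nonneg fun l => norm_nonneg _
  rw [show 6 * (1 / t * A + 1 / t * B) = 6 * (A + B) / t by ring, le_div_iff₀ ht]
  linarith
end
end

section
/- Let χ be a fixed smooth function on ℝ with χ(s) = 1 for |s| ≤ 1/2 and χ(s) = 0 for |s| ≥ 1, and set χ̃ = 1 − χ. Define Ỹ₀(s) = χ̃(s) Y₀(s) for s > 0 (extended by 0 for s ≤ 1/2). Then there is a constant C (depending only on χ) such that for all λ > 0 and all z ∈ ℝ with z ≠ 0: |Ỹ₀(λ|z|)| ≤ C λ^{1/2} |z|^{1/2}, |∂_λ Ỹ₀(λ|z|)| ≤ C λ^{−1/2} |z|^{1/2}, and |∂_λ² Ỹ₀(λ|z|)| ≤ C λ^{−1/2} |z|^{3/2}. -/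
open MeasureTheory Real Set Filter

noncomputable section

/-- The Bessel function of the second kind of order zero, defined for `z > 0` by the
(improper) integral `Y₀(z) = −(2/π) lim_{T→∞} ∫₀^T cos(z cosh t) dt`. -/
def Y0 (z : ℝ) : ℝ :=
  -(2 / Real.pi) * limUnder atTop (fun T : ℝ => ∫ t in (0:ℝ)..T, Real.cos (z * Real.cosh t))

theorem tendsto_sinh_atTop : Tendsto sinh atTop atTop :=
  tendsto_atTop_mono' _ (by
    filter_upwards [eventually_ge_atTop 0] with x hx using self_le_sinh_iff.2 hx) tendsto_id

theorem integral_cos_mul_cosh_eq (z T : ℝ) :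
    ∫ t in (0:ℝ)..T, cos (z * cosh t) =
      (∫ t in (0:ℝ)..T, exp (-(z * sinh t))) - (∫ θ in (0:ℝ)..(π / 2), sin (z * cos θ)) +
        ∫ θ in (0:ℝ)..(π / 2), exp (-(z * sinh T * sin θ)) * sin (z * cosh T * cos θ) := by
  set f : ℂ → ℂ := fun w => Complex.exp (Complex.I * z * Complex.cosh w) with hf
  have hfd : Differentiable ℂ f := by
    intro w
    exact ((Complex.differentiable_cosh w).const_mul _).cexp
  have hfc : Continuous f := hfd.continuous
  have key := Complex.integral_boundary_rect_eq_zero_of_differentiableOn f 0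
    (T + (π / 2 : ℝ) * Complex.I) hfd.differentiableOn
  have hval : ∀ x y : ℝ, f (x + y * Complex.I) =
      Complex.exp (((-(z * sinh x * sin y) : ℝ) : ℂ) + ((z * cosh x * cos y : ℝ) : ℂ) * Complex.I) := by
    intro x y
    simp only [hf]
    congr 1
    rw [Complex.cosh_add, Complex.cosh_mul_I, Complex.sinh_mul_I]
    push_cast
    linear_combination (z * Complex.sinh x * Complex.sin y) * Complex.I_sq
  have hre : ∀ x y : ℝ, (f (x + y * Complex.I)).re =
      exp (-(z * sinh x * sin y)) * cos (z * cosh x * cos y) := by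
    intro x y
    have : ∀ a b : ℝ, (Complex.exp (a + b * Complex.I)).re = exp a * cos b := by
      intro a b
      simp [Complex.exp_re]
    rw [hval, this]
  have him : ∀ x y : ℝ, (f (x + y * Complex.I)).im =
      exp (-(z * sinh x * sin y)) * sin (z * cosh x * cos y) := by
    intro x y
    have : ∀ a b : ℝ, (Complex.exp (a + b * Complex.I)).im = exp a * sin b := by
      intro a b
      simp [Complex.exp_im]
    rw [hval, this]
  have re_int : ∀ (g : ℝ → ℂ) (a b : ℝ), Continuous g →
      (∫ t in a..b, g t).re = ∫ t in a..b, (g t).re := fun g a b hg =>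
    (Complex.reCLM.intervalIntegral_comp_comm (hg.intervalIntegrable a b)).symm
  have im_int : ∀ (g : ℝ → ℂ) (a b : ℝ), Continuous g →
      (∫ t in a..b, g t).im = ∫ t in a..b, (g t).im := fun g a b hg =>
    (Complex.imCLM.intervalIntegral_comp_comm (hg.intervalIntegrable a b)).symm
  have h := congrArg Complex.re key
  simp only [Complex.add_re, Complex.sub_re, smul_eq_mul, Complex.I_mul_re, Complex.zero_re,
    Complex.zero_im, Complex.add_im, Complex.ofReal_re, Complex.ofReal_im, Complex.re_ofReal_mul,
    Complex.im_ofReal_mul, Complex.I_re, Complex.I_im, mul_zero, mul_one, add_zero, zero_add] at h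
  rw [re_int _ _ _ (by fun_prop), re_int _ _ _ (by fun_prop), im_int _ _ _ (by fun_prop),
    im_int _ _ _ (by fun_prop)] at h
  simp only [hre, him] at h
  simp at h
  linarith

theorem tendsto_integral_cos_mul_cosh_remainder {z : ℝ} (hz : 0 < z) :
    Tendsto (fun T : ℝ => ∫ θ in (0:ℝ)..(π / 2),
      exp (-(z * sinh T * sin θ)) * sin (z * cosh T * cos θ)) atTop (nhds 0) := by
  have hpi := pi_pos
  have := intervalIntegral.tendsto_integral_filter_of_dominated_convergence
    (μ := volume) (a := 0) (b := π / 2) (l := atTop)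
    (F := fun (T : ℝ) θ => exp (-(z * sinh T * sin θ)) * sin (z * cosh T * cos θ))
    (f := fun _ => (0:ℝ)) (fun _ => (1:ℝ)) ?_ ?_ ?_ ?_
  · simpa using this
  · exact Eventually.of_forall fun T => Continuous.aestronglyMeasurable (by fun_prop)
  · filter_upwards [eventually_ge_atTop 0] with T hT
    refine Eventually.of_forall fun θ hθ => ?_
    rw [uIoc_of_le (by positivity)] at hθ
    have hs : 0 ≤ sin θ := sin_nonneg_of_nonneg_of_le_pi hθ.1.le (by linarith [hθ.2])
    have hT' := sinh_nonneg_iff.2 hT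
    rw [norm_mul, norm_eq_abs, norm_eq_abs, abs_exp]
    exact mul_le_one₀ (exp_le_one_iff.2 (by
      have : 0 ≤ z * sinh T * sin θ := by positivity
      linarith)) (abs_nonneg _) (abs_sin_le_one _)
  · simp
  · refine Eventually.of_forall fun θ hθ => ?_
    rw [uIoc_of_le (by positivity)] at hθ
    have hs : 0 < sin θ := sin_pos_of_pos_of_lt_pi hθ.1 (by linarith [hθ.2])
    have h1 : Tendsto (fun T => exp (-(z * sinh T * sin θ))) atTop (nhds 0) :=
      tendsto_exp_neg_atTop_nhds_zero.comp ((tendsto_sinh_atTop.const_mul_atTop hz).atTop_mul_const hs)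
    refine squeeze_zero_norm (fun T => ?_) h1
    rw [norm_mul, norm_eq_abs, norm_eq_abs, abs_exp]
    exact mul_le_of_le_one_right (exp_pos _).le (abs_sin_le_one _)

/-- The Laplace-type integral `∫₀^∞ sinhⁿ(t) exp(-z sinh t) dt`. -/
def sinhLaplace (n : ℕ) (z : ℝ) : ℝ := ∫ t in Ioi (0:ℝ), sinh t ^ n * exp (-(z * sinh t))

theorem integrableOn_sinh_pow_mul_exp (n : ℕ) {z : ℝ} (hz : 0 < z) :
    IntegrableOn (fun t => sinh t ^ n * exp (-(z * sinh t))) (Ioi 0) := by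
  have hb := (exp_neg_integrableOn_Ioi 0 (half_pos hz)).const_mul (n.factorial * (2 / z) ^ n)
  refine hb.mono' (Continuous.aestronglyMeasurable (by fun_prop)) ?_
  filter_upwards [ae_restrict_mem measurableSet_Ioi] with t (ht : 0 < t)
  have hs : t ≤ sinh t := self_le_sinh_iff.2 ht.le
  have hs0 : 0 ≤ sinh t := ht.le.trans hs
  rw [norm_eq_abs, abs_of_nonneg (by positivity)]
  have h1 := pow_div_factorial_le_exp (z / 2 * sinh t) (by positivity) n
  rw [div_le_iff₀ (by positivity), mul_pow] at h1
  have h2 : sinh t ^ n ≤ n.factorial * (2 / z) ^ n * exp (z / 2 * sinh t) := by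
    calc sinh t ^ n = (2 / z) ^ n * ((z / 2) ^ n * sinh t ^ n) := by
          rw [← mul_assoc, ← mul_pow, div_mul_div_cancel₀ hz.ne', div_self two_ne_zero, one_pow,
            one_mul]
      _ ≤ (2 / z) ^ n * (exp (z / 2 * sinh t) * n.factorial) := by gcongr
      _ = _ := by ring
  calc sinh t ^ n * exp (-(z * sinh t))
      ≤ n.factorial * (2 / z) ^ n * exp (z / 2 * sinh t) * exp (-(z * sinh t)) := by gcongr
    _ = n.factorial * (2 / z) ^ n * exp (-(z / 2) * sinh t) := by
        rw [mul_assoc, ← exp_add]; ring_nf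
    _ ≤ n.factorial * (2 / z) ^ n * exp (-(z / 2) * t) := by
        gcongr ?_ * exp ?_
        nlinarith

theorem hasDerivAt_sinhLaplace (n : ℕ) {z : ℝ} (hz : 0 < z) :
    HasDerivAt (sinhLaplace n) (-sinhLaplace (n + 1) z) z := by
  have h := hasDerivAt_integral_of_dominated_loc_of_deriv_le
    (μ := volume.restrict (Ioi (0:ℝ))) (x₀ := z) (s := Ioi (z / 2))
    (F := fun x t => sinh t ^ n * exp (-(x * sinh t)))
    (F' := fun x t => -(sinh t ^ (n + 1) * exp (-(x * sinh t))))
    (bound := fun t => sinh t ^ (n + 1) * exp (-(z / 2 * sinh t)))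
    (Ioi_mem_nhds (by linarith))
    (Eventually.of_forall fun x => Continuous.aestronglyMeasurable (by fun_prop))
    (integrableOn_sinh_pow_mul_exp n hz)
    (Continuous.aestronglyMeasurable (by fun_prop)) ?_
    (integrableOn_sinh_pow_mul_exp (n + 1) (half_pos hz)) ?_
  · have h2 := h.2
    rwa [integral_neg] at h2
  · filter_upwards [ae_restrict_mem measurableSet_Ioi] with t (ht : 0 < t) x (hx : z / 2 < x)
    have hs0 : 0 ≤ sinh t := sinh_nonneg_iff.2 ht.le
    rw [norm_neg, norm_eq_abs, abs_of_nonneg (by positivity)]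
    gcongr
  · refine Eventually.of_forall fun t x _ => ?_
    have := (((hasDerivAt_id x).mul_const (sinh t)).neg.exp).const_mul (sinh t ^ n)
    convert! this using 1
    simp only [id, Pi.neg_apply]
    ring

theorem sinhLaplace_ode {z : ℝ} (hz : 0 < z) :
    sinhLaplace 2 z - sinhLaplace 1 z / z + sinhLaplace 0 z = 1 / z := by
  have hi := fun n => integrableOn_sinh_pow_mul_exp n hz
  have hd : ∀ t : ℝ, HasDerivAt (fun t => cosh t * exp (-(z * sinh t)))
      (sinh t ^ 1 * exp (-(z * sinh t)) - z * (sinh t ^ 2 * exp (-(z * sinh t))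
        + sinh t ^ 0 * exp (-(z * sinh t)))) t := by
    intro t
    have := (hasDerivAt_cosh t).mul ((hasDerivAt_sinh t).const_mul z).neg.exp
    convert! this using 1
    linear_combination (z * exp (-(z * sinh t))) * cosh_sq t
  have hlim : Tendsto (fun t => cosh t * exp (-(z * sinh t))) atTop (nhds 0) := by
    have h1 : Tendsto (fun u : ℝ => (1 + z⁻¹ * u) * exp (-u)) atTop (nhds 0) := by
      have := tendsto_exp_neg_atTop_nhds_zero.add
        ((tendsto_pow_mul_exp_neg_atTop_nhds_zero 1).const_mul z⁻¹)
      simp only [mul_zero, add_zero] at this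
      refine this.congr fun u => ?_
      ring
    refine squeeze_zero' (Eventually.of_forall fun t => by positivity) ?_
      (h1.comp (tendsto_sinh_atTop.const_mul_atTop hz))
    filter_upwards [eventually_ge_atTop 0] with t ht
    have hs := sinh_nonneg_iff.2 ht
    simp only [Function.comp]
    rw [inv_mul_cancel_left₀ hz.ne']
    gcongr
    nlinarith [cosh_sq t, one_le_cosh t]
  have hi20 : IntegrableOn (fun t => sinh t ^ 2 * exp (-(z * sinh t)) +
      sinh t ^ 0 * exp (-(z * sinh t))) (Ioi 0) := (hi 2).add (hi 0)
  have h := integral_Ioi_of_hasDerivAt_of_tendsto' (a := 0) (fun t _ => hd t)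
    ((hi 1).sub (hi20.const_mul z)) hlim
  have e : ∫ t in Ioi (0:ℝ), (sinh t ^ 1 * exp (-(z * sinh t)) - z * (sinh t ^ 2 * exp (-(z * sinh t))
        + sinh t ^ 0 * exp (-(z * sinh t)))) =
      sinhLaplace 1 z - z * (sinhLaplace 2 z + sinhLaplace 0 z) := by
    rw [integral_sub (hi 1) (hi20.const_mul z), integral_const_mul,
      integral_add (hi 2) (hi 0)]
    rfl
  rw [e] at h
  simp at h
  field_simp
  linarith
theorem hasDerivAt_integral_sin_mul_cos (z : ℝ) :
    HasDerivAt (fun x => ∫ θ in (0:ℝ)..(π / 2), sin (x * cos θ))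
      (∫ θ in (0:ℝ)..(π / 2), cos θ * cos (z * cos θ)) z := by
  refine (intervalIntegral.hasDerivAt_integral_of_dominated_loc_of_deriv_le
    (F := fun x θ => sin (x * cos θ)) (F' := fun x θ => cos θ * cos (x * cos θ))
    (bound := fun _ => 1) univ_mem
    (Eventually.of_forall fun x => Continuous.aestronglyMeasurable (by fun_prop))
    (Continuous.intervalIntegrable (by fun_prop) _ _)
    (Continuous.aestronglyMeasurable (by fun_prop)) ?_ (by simp) ?_).2
  · refine Eventually.of_forall fun θ _ x _ => ?_
    rw [norm_mul]
    exact mul_le_one₀ (abs_cos_le_one _) (norm_nonneg _) (abs_cos_le_one _)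
  · refine Eventually.of_forall fun θ _ x _ => ?_
    convert! ((hasDerivAt_id x).mul_const (cos θ)).sin using 1
    simp only [id]; ring

theorem hasDerivAt_integral_cos_mul_cos (z : ℝ) :
    HasDerivAt (fun x => ∫ θ in (0:ℝ)..(π / 2), cos θ * cos (x * cos θ))
      (-∫ θ in (0:ℝ)..(π / 2), cos θ ^ 2 * sin (z * cos θ)) z := by
  rw [← intervalIntegral.integral_neg]
  refine (intervalIntegral.hasDerivAt_integral_of_dominated_loc_of_deriv_le
    (F := fun x θ => cos θ * cos (x * cos θ)) (F' := fun x θ => -(cos θ ^ 2 * sin (x * cos θ)))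
    (bound := fun _ => 1) univ_mem
    (Eventually.of_forall fun x => Continuous.aestronglyMeasurable (by fun_prop))
    (Continuous.intervalIntegrable (by fun_prop) _ _)
    (Continuous.aestronglyMeasurable (by fun_prop)) ?_ (by simp) ?_).2
  · refine Eventually.of_forall fun θ _ x _ => ?_
    rw [norm_neg, norm_mul, norm_pow]
    exact mul_le_one₀ (pow_le_one₀ (norm_nonneg _) (abs_cos_le_one _)) (norm_nonneg _)
      (abs_sin_le_one _)
  · refine Eventually.of_forall fun θ _ x _ => ?_
    convert! ((hasDerivAt_id x).mul_const (cos θ)).cos.const_mul (cos θ) using 1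
    simp only [id]; ring

theorem integral_sin_mul_cos_ode {z : ℝ} (hz : z ≠ 0) :
    -(∫ θ in (0:ℝ)..(π / 2), cos θ ^ 2 * sin (z * cos θ)) +
      (∫ θ in (0:ℝ)..(π / 2), cos θ * cos (z * cos θ)) / z +
      (∫ θ in (0:ℝ)..(π / 2), sin (z * cos θ)) = 1 / z := by
  have hd : ∀ θ : ℝ, HasDerivAt (fun θ => sin θ * cos (z * cos θ))
      (cos θ * cos (z * cos θ) + z * (sin (z * cos θ) - cos θ ^ 2 * sin (z * cos θ))) θ := by
    intro θ
    convert! (hasDerivAt_sin θ).mul ((hasDerivAt_cos θ).const_mul z).cos using 1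
    linear_combination (-(z * sin (z * cos θ))) * sin_sq_add_cos_sq θ
  have i1 : IntervalIntegrable (fun θ => cos θ * cos (z * cos θ)) volume 0 (π / 2) :=
    Continuous.intervalIntegrable (by fun_prop) _ _
  have i2 : IntervalIntegrable (fun θ => sin (z * cos θ)) volume 0 (π / 2) :=
    Continuous.intervalIntegrable (by fun_prop) _ _
  have i3 : IntervalIntegrable (fun θ => cos θ ^ 2 * sin (z * cos θ)) volume 0 (π / 2) :=
    Continuous.intervalIntegrable (by fun_prop) _ _
  have h := intervalIntegral.integral_eq_sub_of_hasDerivAt (a := 0) (b := π / 2)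
    (fun θ _ => hd θ) (i1.add ((i2.sub i3).const_mul z))
  rw [intervalIntegral.integral_add i1 ((i2.sub i3).const_mul z),
    intervalIntegral.integral_const_mul, intervalIntegral.integral_sub i2 i3] at h
  simp only [sin_pi_div_two, cos_pi_div_two, mul_zero, cos_zero, sin_zero, mul_one, zero_mul,
    sub_zero] at h
  rw [eq_div_iff hz, add_mul, add_mul, div_mul_cancel₀ _ hz]
  linarith

/-- Energy estimate for solutions of the Bessel equation of order zero. -/
theorem bessel_ode_bound {y y₁ : ℝ → ℝ} {a : ℝ} (ha : 0 < a)
    (h0 : ∀ x, 0 < x → HasDerivAt y (y₁ x) x)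
    (h1 : ∀ x, 0 < x → HasDerivAt y₁ (-y₁ x / x - y x) x) :
    ∃ K, 0 < K ∧ ∀ x, a ≤ x → |y x| ≤ K * x ^ (-(1:ℝ) / 2) ∧ |y₁ x| ≤ K * x ^ (-(1:ℝ) / 2) := by
  set E : ℝ → ℝ := fun x => x * y₁ x ^ 2 + y x * y₁ x + y x ^ 2 / (2 * x) + x * y x ^ 2 with hE
  have hEd : ∀ x, 0 < x → HasDerivAt E (-(y x ^ 2 / (2 * x ^ 2))) x := by
    intro x hx
    have d0 := h0 x hx
    have d1 := h1 x hx
    convert! ((((hasDerivAt_id x).mul (d1.pow 2)).add (d0.mul d1)).add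
      ((d0.pow 2).div ((hasDerivAt_id x).const_mul 2) (by simpa using hx.ne'))).add
      ((hasDerivAt_id x).mul (d0.pow 2)) using 1
    simp
    field_simp
    ring
  have hanti : AntitoneOn E (Ici a) := by
    refine antitoneOn_of_deriv_nonpos (convex_Ici a)
      (fun x hx => (hEd x (ha.trans_le hx)).continuousAt.continuousWithinAt) ?_ ?_
    · intro x hx
      rw [interior_Ici] at hx
      exact (hEd x (ha.trans hx)).differentiableAt.differentiableWithinAt
    · intro x hx
      rw [interior_Ici] at hx
      rw [(hEd x (ha.trans hx)).deriv]
      have : 0 ≤ y x ^ 2 / (2 * x ^ 2) := by positivity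
      linarith
  have hsplit : ∀ x, 0 < x →
      E x = x / 2 * y₁ x ^ 2 + x * y x ^ 2 + (x * y₁ x + y x) ^ 2 / (2 * x) := by
    intro x hx
    simp only [hE]
    field_simp
    ring
  refine ⟨√(2 * |E a| + 1), by positivity, fun x hx => ?_⟩
  have hx0 : 0 < x := ha.trans_le hx
  have hle : E x ≤ |E a| := (hanti self_mem_Ici hx hx).trans (le_abs_self _)
  have hq : 0 ≤ (x * y₁ x + y x) ^ 2 / (2 * x) := by positivity
  have hs := hsplit x hx0
  have hp : x ^ (-(1:ℝ) / 2) = (√x)⁻¹ := by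
    rw [neg_div, rpow_neg hx0.le, sqrt_eq_rpow]
  have hy0 : 0 ≤ x * y x ^ 2 := by positivity
  have hy1 : 0 ≤ x * y₁ x ^ 2 := by positivity
  have bound : ∀ v : ℝ, x * v ^ 2 ≤ 2 * |E a| + 1 → |v| ≤ √(2 * |E a| + 1) * (√x)⁻¹ := by
    intro v hv
    rw [← div_eq_mul_inv, ← sqrt_div' _ hx0.le]
    refine abs_le_sqrt ?_
    rw [le_div_iff₀ hx0]
    linarith
  rw [hp]
  exact ⟨bound _ (by linarith [abs_nonneg (E a)]), bound _ (by linarith)⟩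
theorem Y0_eq {z : ℝ} (hz : 0 < z) :
    Y0 z = -(2 / π) * (sinhLaplace 0 z - ∫ θ in (0:ℝ)..(π / 2), sin (z * cos θ)) := by
  have hi : IntegrableOn (fun t => exp (-(z * sinh t))) (Ioi 0) := by
    simpa using integrableOn_sinh_pow_mul_exp 0 hz
  have h := ((intervalIntegral_tendsto_integral_Ioi 0 hi tendsto_id).sub_const
    (∫ θ in (0:ℝ)..(π / 2), sin (z * cos θ))).add (tendsto_integral_cos_mul_cosh_remainder hz)
  have hlim : Tendsto (fun T : ℝ => ∫ t in (0:ℝ)..T, cos (z * cosh t)) atTop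
      (nhds (sinhLaplace 0 z - ∫ θ in (0:ℝ)..(π / 2), sin (z * cos θ))) := by
    simp only [integral_cos_mul_cosh_eq]
    simpa [sinhLaplace] using h
  rw [Y0, hlim.limUnder_eq]

/-- The derivative of `Y0` on the positive half-line. -/
def Y0Deriv (z : ℝ) : ℝ :=
  -(2 / π) * (-sinhLaplace 1 z - ∫ θ in (0:ℝ)..(π / 2), cos θ * cos (z * cos θ))

theorem hasDerivAt_Y0 {z : ℝ} (hz : 0 < z) : HasDerivAt Y0 (Y0Deriv z) z := by
  refine (((hasDerivAt_sinhLaplace 0 hz).sub (hasDerivAt_integral_sin_mul_cos z)).const_mul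
    (-(2 / π))).congr_of_eventuallyEq ?_
  filter_upwards [Ioi_mem_nhds hz] with x hx using Y0_eq hx

theorem hasDerivAt_Y0Deriv {z : ℝ} (hz : 0 < z) :
    HasDerivAt Y0Deriv (-Y0Deriv z / z - Y0 z) z := by
  have h := ((hasDerivAt_sinhLaplace 1 hz).neg.sub
    (hasDerivAt_integral_cos_mul_cos z)).const_mul (-(2 / π))
  convert! h using 1
  rw [Y0_eq hz, Y0Deriv]
  linear_combination (-(2 / π)) * integral_sin_mul_cos_ode hz.ne' + (2 / π) * sinhLaplace_ode hz

/-- A smooth cut-off function and its first two derivatives are uniformly bounded. -/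
theorem exists_cutoff_bound {χ : ℝ → ℝ} (hχ : ContDiff ℝ (⊤ : ℕ∞) χ)
    (hχ0 : ∀ s : ℝ, 1 ≤ |s| → χ s = 0) :
    ∃ M, 0 < M ∧ ∀ s, |1 - χ s| ≤ M ∧ |deriv χ s| ≤ M ∧ |deriv (deriv χ) s| ≤ M := by
  have hsupp : HasCompactSupport χ :=
    HasCompactSupport.intro (isCompact_Icc (a := -1) (b := 1)) fun s hs => hχ0 s <| by
      by_contra hlt
      exact hs (abs_le.1 (not_le.1 hlt).le)
  have hd1 : Continuous (deriv χ) := hχ.continuous_deriv (by simp)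
  have hd2 : Continuous (deriv (deriv χ)) := by
    have := (contDiff_infty.1 hχ 2).continuous_iteratedDeriv 2 le_rfl
    rwa [iteratedDeriv_succ, iteratedDeriv_one] at this
  obtain ⟨A, hA⟩ := hχ.continuous.bounded_above_of_compact_support hsupp
  obtain ⟨B, hB⟩ := hd1.bounded_above_of_compact_support hsupp.deriv
  obtain ⟨D, hD⟩ := hd2.bounded_above_of_compact_support hsupp.deriv.deriv
  have hA0 := (norm_nonneg _).trans (hA 0)
  have hB0 := (norm_nonneg _).trans (hB 0)
  have hD0 := (norm_nonneg _).trans (hD 0)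
  refine ⟨1 + A + B + D, by positivity, fun s => ⟨?_, ?_, ?_⟩⟩
  · have h1 := abs_sub (1:ℝ) (χ s)
    have h2 := hA s
    rw [norm_eq_abs] at h2
    rw [abs_one] at h1
    linarith
  · have h2 := hB s
    rw [norm_eq_abs] at h2
    linarith
  · have h2 := hD s
    rw [norm_eq_abs] at h2
    linarith

theorem exists_cutoff_mul_Y0_bound {χ : ℝ → ℝ} (hχ : ContDiff ℝ (⊤ : ℕ∞) χ)
    (hχ1 : ∀ s : ℝ, |s| ≤ 1 / 2 → χ s = 1) (hχ0 : ∀ s : ℝ, 1 ≤ |s| → χ s = 0) :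
    ∃ C, 0 < C ∧ ∃ g₁ g₂ : ℝ → ℝ, ∀ x, 0 < x →
      HasDerivAt (fun x => (1 - χ x) * Y0 x) (g₁ x) x ∧ HasDerivAt g₁ (g₂ x) x ∧
      |(1 - χ x) * Y0 x| ≤ C * x ^ ((1:ℝ) / 2) ∧ |g₁ x| ≤ C * x ^ (-(1:ℝ) / 2) ∧
      |g₂ x| ≤ C * x ^ (-(1:ℝ) / 2) := by
  obtain ⟨K, hK, hY⟩ := bessel_ode_bound (a := 1 / 2) (by norm_num)
    (fun x hx => hasDerivAt_Y0 hx) (fun x hx => hasDerivAt_Y0Deriv hx)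
  obtain ⟨M, hM, hχM⟩ := exists_cutoff_bound hχ hχ0
  have hd1 : ∀ x, HasDerivAt χ (deriv χ x) x := fun x =>
    (hχ.differentiable (by simp) x).hasDerivAt
  have hd2 : ∀ x, HasDerivAt (deriv χ) (deriv (deriv χ) x) x := by
    have h : ContDiff ℝ 1 (deriv χ) := by
      have h2 : ContDiff ℝ (1 + 1) χ := by
        exact_mod_cast contDiff_infty.1 hχ (1 + 1)
      exact (contDiff_succ_iff_deriv.1 h2).2.2
    exact fun x => (h.differentiable (by simp) x).hasDerivAt
  refine ⟨6 * M * K, by positivity,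
    fun x => -deriv χ x * Y0 x + (1 - χ x) * Y0Deriv x,
    fun x => -deriv (deriv χ) x * Y0 x + -deriv χ x * Y0Deriv x +
      (-deriv χ x * Y0Deriv x + (1 - χ x) * (-Y0Deriv x / x - Y0 x)), fun x hx => ?_⟩
  refine ⟨((hd1 x).const_sub 1).mul (hasDerivAt_Y0 hx),
    ((hd2 x).neg.mul (hasDerivAt_Y0 hx)).add
      (((hd1 x).const_sub 1).mul (hasDerivAt_Y0Deriv hx)), ?_⟩
  rcases lt_or_ge x (1 / 2) with hlt | hge
  · have hev : χ =ᶠ[nhds x] fun _ => 1 := by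
      filter_upwards [Ioo_mem_nhds hx hlt] with s hs
      exact hχ1 s (by rw [abs_of_pos hs.1]; exact hs.2.le)
    have e0 : χ x = 1 := hev.eq_of_nhds
    have e1 : deriv χ x = 0 := by simpa using hev.deriv_eq
    have e2 : deriv (deriv χ) x = 0 := by simpa using hev.deriv.deriv_eq
    simp only [e0, e1, e2, sub_self, zero_mul, neg_zero, add_zero, abs_zero]
    refine ⟨?_, ?_, ?_⟩ <;> positivity
  · obtain ⟨hy, hy1⟩ := hY x hge
    obtain ⟨m0, m1, m2⟩ := hχM x
    set p := x ^ (-(1:ℝ) / 2) with hp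
    have hp0 : 0 < p := by positivity
    have hy2 : |-Y0Deriv x / x - Y0 x| ≤ 3 * (K * p) := by
      have h1 := abs_sub (-Y0Deriv x / x) (Y0 x)
      have h2 : |-Y0Deriv x / x| ≤ 2 * (K * p) := by
        rw [abs_div, abs_neg, abs_of_pos hx, div_le_iff₀ hx]
        nlinarith [mul_pos hK hp0]
      linarith
    have hprod : ∀ u v B : ℝ, |u| ≤ M → |v| ≤ B → |u * v| ≤ M * B := fun u v B hu hv => by
      rw [abs_mul]
      exact mul_le_mul hu hv (abs_nonneg _) hM.le
    have n1 : |-deriv χ x| ≤ M := by rwa [abs_neg]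
    have n2 : |-deriv (deriv χ) x| ≤ M := by rwa [abs_neg]
    have hMKp : 0 < M * (K * p) := by positivity
    refine ⟨?_, ?_, ?_⟩
    · have hpx : p ≤ 2 * x ^ ((1:ℝ) / 2) := by
        have : x ^ ((1:ℝ) / 2) = x * p := by
          rw [hp, ← rpow_one_add' hx.le (by norm_num)]
          norm_num
        rw [this]
        nlinarith
      have h := hprod _ _ _ m0 hy
      have h2 : M * (K * p) ≤ M * (K * (2 * x ^ ((1:ℝ) / 2))) := by gcongr
      have h3 : 0 < M * K * x ^ ((1:ℝ) / 2) := by positivity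
      linarith
    · have h := abs_add_le (-deriv χ x * Y0 x) ((1 - χ x) * Y0Deriv x)
      linarith [hprod _ _ _ n1 hy, hprod _ _ _ m0 hy1]
    · have h := abs_add_le (-deriv (deriv χ) x * Y0 x + -deriv χ x * Y0Deriv x)
        (-deriv χ x * Y0Deriv x + (1 - χ x) * (-Y0Deriv x / x - Y0 x))
      have h' := abs_add_le (-deriv (deriv χ) x * Y0 x) (-deriv χ x * Y0Deriv x)
      have h'' := abs_add_le (-deriv χ x * Y0Deriv x) ((1 - χ x) * (-Y0Deriv x / x - Y0 x))
      linarith [hprod _ _ _ n2 hy, hprod _ _ _ n1 hy1, hprod _ _ _ m0 hy2]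

/-- Bounds on the high-energy part `Ỹ₀ = (1-χ)Y₀` of the Bessel function:
`|Ỹ₀(λ|z|)| ≲ λ^{1/2}|z|^{1/2}`, `|∂_λ Ỹ₀(λ|z|)| ≲ λ^{-1/2}|z|^{1/2}`,
`|∂_λ² Ỹ₀(λ|z|)| ≲ λ^{-1/2}|z|^{3/2}`. -/
theorem high_energy_Y0_bounds
    (χ : ℝ → ℝ) (hχ : ContDiff ℝ (⊤ : ℕ∞) χ)
    (hχ1 : ∀ s : ℝ, |s| ≤ 1 / 2 → χ s = 1)
    (hχ0 : ∀ s : ℝ, 1 ≤ |s| → χ s = 0) :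
    ∃ C : ℝ, 0 < C ∧ ∀ l : ℝ, 0 < l → ∀ z : ℝ, z ≠ 0 →
      |(1 - χ (l * |z|)) * Y0 (l * |z|)| ≤ C * l ^ ((1:ℝ)/2) * |z| ^ ((1:ℝ)/2) ∧
      |deriv (fun s : ℝ => (1 - χ (s * |z|)) * Y0 (s * |z|)) l| ≤
        C * l ^ (-(1:ℝ)/2) * |z| ^ ((1:ℝ)/2) ∧
      |iteratedDeriv 2 (fun s : ℝ => (1 - χ (s * |z|)) * Y0 (s * |z|)) l| ≤
        C * l ^ (-(1:ℝ)/2) * |z| ^ ((3:ℝ)/2) := by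
  obtain ⟨C, hC, g₁, g₂, hg⟩ := exists_cutoff_mul_Y0_bound hχ hχ1 hχ0
  refine ⟨C, hC, fun l hl z hz => ?_⟩
  have ha : 0 < |z| := abs_pos.2 hz
  set a := |z|
  have hmul : ∀ s : ℝ, HasDerivAt (fun s => s * a) a s := fun s => by
    simpa using (hasDerivAt_id s).mul_const a
  have h1 : ∀ s : ℝ, 0 < s →
      HasDerivAt (fun s => (1 - χ (s * a)) * Y0 (s * a)) (g₁ (s * a) * a) s := fun s hs => by
    have := (hg (s * a) (mul_pos hs ha)).1.comp s (hmul s)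
    exact this
  have h2 : HasDerivAt (deriv fun s => (1 - χ (s * a)) * Y0 (s * a)) (g₂ (l * a) * a * a) l := by
    refine (((hg (l * a) (mul_pos hl ha)).2.1.comp l (hmul l)).mul_const a).congr_of_eventuallyEq ?_
    filter_upwards [Ioi_mem_nhds hl] with s hs using (h1 s hs).deriv
  obtain ⟨-, -, b0, b1, b2⟩ := hg (l * a) (mul_pos hl ha)
  rw [iteratedDeriv_succ, iteratedDeriv_one, (h1 l hl).deriv, h2.deriv]
  rw [mul_rpow hl.le ha.le] at b0 b1 b2
  have ha1 : a ^ (-(1:ℝ) / 2) * a = a ^ ((1:ℝ) / 2) := by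
    rw [← rpow_add_one ha.ne']
    norm_num
  have ha2 : a ^ ((1:ℝ) / 2) * a = a ^ ((3:ℝ) / 2) := by
    rw [← rpow_add_one ha.ne']
    norm_num
  refine ⟨by rwa [mul_assoc], ?_, ?_⟩
  · rw [abs_mul, abs_of_pos ha, ← ha1]
    nlinarith
  · rw [abs_mul, abs_mul, abs_of_pos ha, ← ha2, ← ha1]
    nlinarith [mul_le_mul_of_nonneg_right b2 (mul_pos ha ha).le]
end
end
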